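/- Letting ξ_s = min{x ∈ ℕ : S(x) = s}, both ratios ξ_{s+1}/ξ_s and q(ξ_{s+1})/q(ξ_s) tend to infinity as s → ∞. -/

import Mathlib

open scoped Classical

/-- The largest element of ℙ*₁ = ℙ* ∪ {1} (prime-powers together with 1) not exceeding `x`. -/
noncomputable def q (x : ℕ) : ℕ :=
  sSup {m : ℕ | (IsPrimePow m ∨ m = 1) ∧ m ≤ x}

/-- The prime-power map. -/
noncomputable def P (x : ℕ) : ℕ :=
  if x = 1 then 1
  else if IsPrimePow x then x / x.minFac
  else x - q x

/-- The orbit of `x` under `P`: `orbit x 1 = x` and `orbit x (n+1) = P (orbit x n)`. -/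
noncomputable def orbit (x n : ℕ) : ℕ := P^[n - 1] x

/-- The transient length `T x = min {n ≥ 1 : x_n = 1}`. -/
noncomputable def T (x : ℕ) : ℕ := sInf {n : ℕ | 1 ≤ n ∧ orbit x n = 1}

/-- The settling time `S x = min {n ≥ 1 : x_n ∈ ℙ*₁}`. -/
noncomputable def S (x : ℕ) : ℕ :=
  sInf {n : ℕ | 1 ≤ n ∧ (IsPrimePow (orbit x n) ∨ orbit x n = 1)}

/-- `xi s` is the smallest positive integer with settling time `s`. -/
noncomputable def xi (s : ℕ) : ℕ := sInf {x : ℕ | 0 < x ∧ S x = s}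

open ArithmeticFunction (vonMangoldt)
open Filter Topology

/-- Half of the Fejér kernel, as the cosine transform of the triangle function on `[0, L]`. -/
noncomputable def fejer (L u : ℝ) : ℝ := ∫ t in (0 : ℝ)..L, (1 - t / L) * Real.cos (t * u)

lemma fejer_eq {L u : ℝ} (hL : 0 < L) (hu : u ≠ 0) :
    fejer L u = (1 - Real.cos (L * u)) / (L * u ^ 2) := by
  have hderiv : ∀ t ∈ Set.uIcc 0 L,
      HasDerivAt (fun t ↦ (1 - t / L) * (Real.sin (t * u) / u) - Real.cos (t * u) / (L * u ^ 2))
        ((1 - t / L) * Real.cos (t * u)) t := by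
    intro t _
    have h1 : HasDerivAt (fun t ↦ t * u) u t := by simpa using (hasDerivAt_id t).mul_const u
    have h2 : HasDerivAt (fun t : ℝ ↦ 1 - t / L) (-(1 / L)) t :=
      ((hasDerivAt_id t).div_const L).const_sub 1
    convert! (h2.mul (h1.sin.div_const u)).sub (h1.cos.div_const (L * u ^ 2)) using 1
    field_simp
    ring
  rw [fejer, intervalIntegral.integral_eq_sub_of_hasDerivAt hderiv
    (Continuous.intervalIntegrable (by fun_prop) _ _)]
  simp
  field_simp
  ring

lemma fejer_nonneg {L : ℝ} (hL : 0 < L) (u : ℝ) : 0 ≤ fejer L u := by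
  rcases eq_or_ne u 0 with rfl | hu
  · refine intervalIntegral.integral_nonneg hL.le fun t ht ↦ ?_
    have : t / L ≤ 1 := (div_le_one hL).mpr ht.2
    simpa using this
  · rw [fejer_eq hL hu]
    have := Real.cos_le_one (L * u)
    exact div_nonneg (by linarith) (by positivity)

lemma fejer_le {L u : ℝ} (hL : 0 < L) (hu : u ≠ 0) : fejer L u ≤ 2 / (L * u ^ 2) := by
  rw [fejer_eq hL hu]
  have := Real.neg_one_le_cos (L * u)
  gcongr
  linarith

lemma le_fejer {L u : ℝ} (hL : 0 < L) (hu : u ≠ 0) (h : |L * u| ≤ 1) : L / 4 ≤ fejer L u := by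
  have hb := abs_le.mp (Real.cos_bound h)
  have h4 : |L * u| ^ 4 ≤ (L * u) ^ 2 := by
    rw [← sq_abs (L * u)]
    exact pow_le_pow_of_le_one (abs_nonneg _) h (by norm_num)
  rw [fejer_eq hL hu, le_div_iff₀ (by positivity)]
  nlinarith [hb.2, sq_nonneg (L * u)]

lemma hasSum_fejer {a : ℕ → ℝ} {σ : ℝ} (hσ : 0 < σ)
    (ha : LSeriesSummable (fun n ↦ (a n : ℂ)) σ) (L y : ℝ) :
    HasSum (fun n : ℕ ↦ a n / (n : ℝ) ^ σ * fejer L (y - Real.log n))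
      (∫ t in (0 : ℝ)..L, ((1 - t / L : ℝ) : ℂ) * (Complex.exp (t * y * Complex.I) *
        LSeries (fun n ↦ (a n : ℂ)) (σ + t * Complex.I))).re := by
  set F : ℕ → ℝ → ℂ := fun n t ↦ ((1 - t / L : ℝ) : ℂ) * (Complex.exp (t * y * Complex.I) *
    LSeries.term (fun n ↦ (a n : ℂ)) (σ + t * Complex.I) n) with hF
  have hterm : ∀ n (t : ℝ), Complex.exp (t * y * Complex.I) *
      LSeries.term (fun n ↦ (a n : ℂ)) (σ + t * Complex.I) n =
      ((a n / (n : ℝ) ^ σ : ℝ) : ℂ) * Complex.exp ((t * (y - Real.log n) : ℝ) * Complex.I) := by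
    intro n t
    rcases eq_or_ne n 0 with rfl | hn
    · simp [Real.zero_rpow hσ.ne']
    · have hn' : (n : ℂ) ≠ 0 := by exact_mod_cast hn
      rw [LSeries.term_of_ne_zero hn, Complex.cpow_add _ _ hn', Complex.cpow_def_of_ne_zero hn'
        (t * Complex.I), Complex.ofReal_div, Complex.ofReal_cpow n.cast_nonneg,
        ← Complex.natCast_log]
      have : Complex.exp ((t * (y - Real.log n) : ℝ) * Complex.I) =
          Complex.exp (t * y * Complex.I) / Complex.exp (Real.log n * (t * Complex.I)) := by
        rw [← Complex.exp_sub]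
        push_cast
        ring_nf
      rw [this]
      simp only [Complex.ofReal_natCast]
      ring
  have hF' : ∀ n t, F n t = ((1 - t / L : ℝ) : ℂ) * (((a n / (n : ℝ) ^ σ : ℝ) : ℂ) *
      Complex.exp ((t * (y - Real.log n) : ℝ) * Complex.I)) := by
    intro n t
    rw [hF, ← hterm]
  have hcont : ∀ n, Continuous (F n) := by
    intro n
    rw [funext (hF' n)]
    fun_prop
  have hsum : Summable fun n ↦ |a n / (n : ℝ) ^ σ| := by
    refine ha.norm.congr fun n ↦ ?_
    have h0 := hterm n 0
    simp only [Complex.ofReal_zero, zero_mul, Complex.exp_zero, one_mul, add_zero, mul_one] at h0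
    rw [h0, Complex.norm_real, Real.norm_eq_abs]
  have hsummable : ∀ t : ℝ, LSeriesSummable (fun n ↦ (a n : ℂ)) (σ + t * Complex.I) := fun t ↦
    ha.of_re_le_re (by simp)
  have key : HasSum (fun n ↦ ∫ t in (0 : ℝ)..L, F n t)
      (∫ t in (0 : ℝ)..L, ((1 - t / L : ℝ) : ℂ) * (Complex.exp (t * y * Complex.I) *
        LSeries (fun n ↦ (a n : ℂ)) (σ + t * Complex.I))) := by
    refine intervalIntegral.hasSum_integral_of_dominated_convergence
      (fun n t ↦ |1 - t / L| * |a n / (n : ℝ) ^ σ|) (fun n ↦ (hcont n).aestronglyMeasurable)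
      (fun n ↦ Eventually.of_forall fun t _ ↦ ?_)
      (Eventually.of_forall fun t _ ↦ hsum.mul_left _) ?_
      (Eventually.of_forall fun t _ ↦ ?_)
    · rw [hF', norm_mul, norm_mul, Complex.norm_exp_ofReal_mul_I, Complex.norm_real,
        Complex.norm_real, mul_one, Real.norm_eq_abs, Real.norm_eq_abs]
    · simp only [tsum_mul_left]
      exact Continuous.intervalIntegrable (by fun_prop) _ _
    · exact ((hsummable t).hasSum.mul_left _).mul_left _
  convert! Complex.hasSum_re key using 2 with n
  have hre := Complex.reCLM.intervalIntegral_comp_comm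
    ((hcont n).intervalIntegrable (μ := MeasureTheory.volume) 0 L)
  simp only [Complex.reCLM_apply] at hre
  rw [← hre, fejer, ← intervalIntegral.integral_const_mul]
  refine intervalIntegral.integral_congr fun t _ ↦ ?_
  simp only [hF', Complex.re_ofReal_mul, Complex.exp_ofReal_mul_I_re]
  ring

lemma exists_continuousOn_vonMangoldt_sub_one :
    ∃ H : ℂ → ℂ, ContinuousOn H {s | 1 ≤ s.re} ∧ ∀ s : ℂ, 1 < s.re →
      H s = LSeries (fun n ↦ (vonMangoldt n : ℂ)) s - LSeries (fun _ ↦ ((1 : ℝ) : ℂ)) s := by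
  set Z := DirichletCharacter.LFunctionTrivChar₁ 1 with hZ
  have hZd : Differentiable ℂ Z := DirichletCharacter.differentiable_LFunctionTrivChar₁ 1
  refine ⟨fun s ↦ ArithmeticFunction.vonMangoldt.LFunctionResidueClassAux (1 : ZMod 1) s -
    dslope Z 1 s, ?_, fun s hs ↦ ?_⟩
  · refine (ArithmeticFunction.vonMangoldt.continuousOn_LFunctionResidueClassAux _).sub ?_
    have : ContinuousOn (dslope Z 1) Set.univ :=
      (continuousOn_dslope univ_mem).mpr ⟨hZd.continuous.continuousOn, hZd 1⟩
    exact this.mono (Set.subset_univ _)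
  · have hs1 : s ≠ 1 := by rintro rfl; simp at hs
    have hs1' : s - 1 ≠ 0 := sub_ne_zero.mpr hs1
    have h1 := ArithmeticFunction.vonMangoldt.eqOn_LFunctionResidueClassAux
      (a := (1 : ZMod 1)) isUnit_one hs
    have h2 : (fun n ↦ (ArithmeticFunction.vonMangoldt.residueClass (1 : ZMod 1) n : ℂ)) =
        fun n ↦ (vonMangoldt n : ℂ) := by
      funext n
      rw [ArithmeticFunction.vonMangoldt.residueClass, Set.indicator_of_mem]
      exact Subsingleton.elim _ _
    have h3 : LSeries (fun _ ↦ ((1 : ℝ) : ℂ)) s = riemannZeta s := by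
      rw [← LSeries_one_eq_riemannZeta hs]
      congr 1
    have hZs : Z s = (s - 1) * riemannZeta s := by
      rw [hZ, DirichletCharacter.LFunctionTrivChar₁, Function.update_of_ne hs1,
        DirichletCharacter.LFunctionTrivChar, DirichletCharacter.LFunction_modOne_eq]
    have hZ1 : Z 1 = 1 := by
      rw [hZ, DirichletCharacter.LFunctionTrivChar₁]
      simp
    beta_reduce at h1 ⊢
    rw [h1, h2, h3, dslope_of_ne _ hs1, slope_def_field, hZs, hZ1]
    simp
    field_simp
    ring

lemma summable_one_div_one_add_int_sq : Summable fun j : ℤ ↦ 1 / (1 + (j : ℝ) ^ 2) := by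
  refine Summable.of_norm_bounded_eventually (Real.summable_one_div_int_pow (p := 2) |>.mpr
    one_lt_two) ?_
  filter_upwards [(Set.finite_singleton (0 : ℤ)).compl_mem_cofinite] with j hj
  have hj' : (0 : ℝ) < (j : ℝ) ^ 2 := by
    have : (j : ℝ) ≠ 0 := by exact_mod_cast hj
    positivity
  rw [Real.norm_of_nonneg (by positivity)]
  gcongr
  linarith

lemma exists_sum_vonMangoldt_div_le :
    ∃ C : ℝ, ∀ (y : ℝ) (N : ℕ), ∑ n ∈ Finset.range N,
      vonMangoldt n / n * (1 / (1 + (Real.log n - y) ^ 2)) ≤ C := by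
  set c : ℝ := (Real.log 4 + 4) * Real.exp 1 with hc
  have hc0 : 0 ≤ c := by
    have := Real.log_nonneg (show (1 : ℝ) ≤ 4 by norm_num)
    positivity
  refine ⟨3 * c * ∑' j : ℤ, 1 / (1 + (j : ℝ) ^ 2), fun y N ↦ ?_⟩
  set κ : ℕ → ℕ := fun n ↦ ⌊Real.log n⌋₊ with hκ
  have hlog : ∀ n : ℕ, 0 ≤ Real.log n := Real.log_natCast_nonneg
  have hterm : ∀ n : ℕ, vonMangoldt n / n * (1 / (1 + (Real.log n - y) ^ 2)) ≤
      vonMangoldt n * (Real.exp (-κ n) * (3 * (1 / (1 + (((κ n : ℤ) - ⌊y⌋ : ℤ) : ℝ) ^ 2)))) := by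
    intro n
    rcases Nat.eq_zero_or_pos n with rfl | hn
    · simp
    have hn' : (0 : ℝ) < n := by exact_mod_cast hn
    rw [div_eq_mul_inv, mul_assoc]
    have h1 : (n : ℝ)⁻¹ ≤ Real.exp (-κ n) := by
      rw [Real.exp_neg]
      gcongr
      exact (Real.le_log_iff_exp_le hn').mp (Nat.floor_le (hlog n))
    have h2 : 1 / (1 + (Real.log n - y) ^ 2) ≤
        3 * (1 / (1 + (((κ n : ℤ) - ⌊y⌋ : ℤ) : ℝ) ^ 2)) := by
      rw [mul_one_div, div_le_div_iff₀ (by positivity) (by positivity)]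
      have a1 : (κ n : ℝ) ≤ Real.log n := Nat.floor_le (hlog n)
      have a2 : Real.log n < κ n + 1 := Nat.lt_floor_add_one _
      have a3 := Int.floor_le y
      have a4 := Int.lt_floor_add_one y
      push_cast
      nlinarith [sq_nonneg (2 * (Real.log n - y) - ((κ n : ℝ) - ⌊y⌋)),
        mul_nonneg (show 0 ≤ 1 - (Real.log n - y - ((κ n : ℝ) - ⌊y⌋)) by linarith)
          (show 0 ≤ 1 + (Real.log n - y - ((κ n : ℝ) - ⌊y⌋)) by linarith)]
    gcongr
  have hblock : ∀ k : ℕ, ∑ n ∈ Finset.range N with κ n = k, vonMangoldt n ≤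
      c * Real.exp k := by
    intro k
    calc ∑ n ∈ Finset.range N with κ n = k, vonMangoldt n
        ≤ ∑ n ∈ Finset.Icc 0 ⌊Real.exp (k + 1)⌋₊, vonMangoldt n := by
          refine Finset.sum_le_sum_of_subset_of_nonneg (fun n hn ↦ ?_)
            fun _ _ _ ↦ ArithmeticFunction.vonMangoldt_nonneg
          have hk := (Finset.mem_filter.mp hn).2
          simp only [Finset.mem_Icc, zero_le, true_and]
          refine Nat.le_floor ?_
          rcases Nat.eq_zero_or_pos n with rfl | hn0
          · simpa using (Real.exp_pos _).le
          · rw [← Real.log_le_iff_le_exp (by exact_mod_cast hn0), ← hk]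
            exact (Nat.lt_floor_add_one _).le
      _ = Chebyshev.psi (Real.exp (k + 1)) := (Chebyshev.psi_eq_sum_Icc _).symm
      _ ≤ (Real.log 4 + 4) * Real.exp (k + 1) := Chebyshev.psi_le_const_mul_self (Real.exp_pos _).le
      _ = c * Real.exp k := by rw [Real.exp_add, hc]; ring
  set M := (Finset.range N).sup κ + 1 with hM
  have hmaps : ∀ n ∈ Finset.range N, κ n ∈ Finset.range M := fun n hn ↦
    Finset.mem_range.mpr (Nat.lt_succ_of_le (Finset.le_sup hn))
  calc _ ≤ ∑ n ∈ Finset.range N, vonMangoldt n *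
        (Real.exp (-κ n) * (3 * (1 / (1 + (((κ n : ℤ) - ⌊y⌋ : ℤ) : ℝ) ^ 2)))) :=
        Finset.sum_le_sum fun n _ ↦ hterm n
    _ = ∑ k ∈ Finset.range M, (∑ n ∈ Finset.range N with κ n = k, vonMangoldt n) *
        (Real.exp (-k) * (3 * (1 / (1 + (((k : ℤ) - ⌊y⌋ : ℤ) : ℝ) ^ 2)))) := by
        rw [← Finset.sum_fiberwise_of_maps_to hmaps]
        refine Finset.sum_congr rfl fun k _ ↦ ?_
        rw [Finset.sum_mul]
        refine Finset.sum_congr rfl fun n hn ↦ ?_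
        rw [(Finset.mem_filter.mp hn).2]
    _ ≤ ∑ k ∈ Finset.range M, (c * Real.exp k) *
        (Real.exp (-k) * (3 * (1 / (1 + (((k : ℤ) - ⌊y⌋ : ℤ) : ℝ) ^ 2)))) := by
        refine Finset.sum_le_sum fun k _ ↦ ?_
        gcongr
        exact hblock k
    _ = 3 * c * ∑ k ∈ Finset.range M, 1 / (1 + (((k : ℤ) - ⌊y⌋ : ℤ) : ℝ) ^ 2) := by
        rw [Finset.mul_sum]
        refine Finset.sum_congr rfl fun k _ ↦ ?_
        rw [Real.exp_neg]
        field_simp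
    _ ≤ _ := by
        gcongr
        have hinj : Function.Injective fun k : ℕ ↦ (k : ℤ) - ⌊y⌋ := fun a b h ↦ by
          simpa using h
        rw [← Finset.sum_image (f := fun j : ℤ ↦ 1 / (1 + (j : ℝ) ^ 2))
          (g := fun k : ℕ ↦ (k : ℤ) - ⌊y⌋) hinj.injOn]
        exact summable_one_div_one_add_int_sq.sum_le_tsum _ fun _ _ ↦ by positivity

lemma le_sum_fejer {L y : ℝ} (hL : 1 ≤ L) (hy : 4 * L ≤ Real.exp y) :
    1 / 16 ≤ ∑ n ∈ Finset.Ioc ⌊Real.exp y⌋₊ ⌊Real.exp y * (1 + 1 / L)⌋₊,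
      1 / (n : ℝ) * fejer L (y - Real.log n) := by
  set x := Real.exp y with hx
  have hx0 : 0 < x := Real.exp_pos y
  have hL0 : 0 < L := by linarith
  have hL1 : 1 / L ≤ 1 := by rw [div_le_one hL0]; exact hL
  have hterm : ∀ n ∈ Finset.Ioc ⌊x⌋₊ ⌊x * (1 + 1 / L)⌋₊,
      1 / (2 * x) * (L / 4) ≤ 1 / (n : ℝ) * fejer L (y - Real.log n) := by
    intro n hn
    rw [Finset.mem_Ioc] at hn
    have h1 : x < n := (Nat.floor_lt hx0.le).mp hn.1
    have h2 : (n : ℝ) ≤ x * (1 + 1 / L) := (Nat.le_floor_iff (by positivity)).mp hn.2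
    have hn0 : (0 : ℝ) < n := hx0.trans h1
    have h3 : y < Real.log n := (Real.lt_log_iff_exp_lt hn0).mpr h1
    have h4 : Real.log n - y ≤ 1 / L := by
      have : Real.log n ≤ Real.log (x * (1 + 1 / L)) := Real.log_le_log hn0 h2
      rw [Real.log_mul hx0.ne' (by positivity), hx, Real.log_exp] at this
      have := Real.log_le_sub_one_of_pos (show 0 < 1 + 1 / L by positivity)
      linarith
    gcongr
    · nlinarith
    · refine le_fejer hL0 (by linarith) ?_
      rw [abs_mul, abs_of_pos hL0, abs_of_neg (by linarith)]
      calc L * -(y - Real.log n) ≤ L * (1 / L) := by gcongr; linarith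
        _ = 1 := by field_simp
  have hcard : x / (2 * L) ≤ ((Finset.Ioc ⌊x⌋₊ ⌊x * (1 + 1 / L)⌋₊).card : ℝ) := by
    have hle : ⌊x⌋₊ ≤ ⌊x * (1 + 1 / L)⌋₊ := Nat.floor_mono (by
      have : 0 < 1 / L := by positivity
      nlinarith)
    rw [Nat.card_Ioc, Nat.cast_sub hle]
    have h1 := Nat.floor_le hx0.le
    have h2 := Nat.lt_floor_add_one (x * (1 + 1 / L))
    have h3 : 1 ≤ x / (2 * L) := by
      rw [le_div_iff₀ (by positivity)]
      linarith
    have h4 : x * (1 + 1 / L) = x + 2 * (x / (2 * L)) := by field_simp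
    linarith
  calc (1 / 16 : ℝ) = x / (2 * L) * (1 / (2 * x) * (L / 4)) := by field_simp; norm_num
    _ ≤ (Finset.Ioc ⌊x⌋₊ ⌊x * (1 + 1 / L)⌋₊).card * (1 / (2 * x) * (L / 4)) := by gcongr
    _ ≤ _ := by
      rw [← nsmul_eq_mul]
      exact Finset.card_nsmul_le_sum _ _ _ hterm

lemma tendsto_integral_mul_exp {f : ℝ → ℂ} (L : ℝ) (hL : 0 ≤ L) :
    Tendsto (fun y : ℝ ↦ ∫ t in (0 : ℝ)..L, Complex.exp (t * y * Complex.I) * f t)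
      atTop (𝓝 0) := by
  have h := Real.tendsto_integral_exp_smul_cocompact (Set.indicator (Set.Ioc 0 L) f)
  have hw : Tendsto (fun y : ℝ ↦ -(y / (2 * Real.pi))) atTop (cocompact ℝ) :=
    (tendsto_neg_atTop_atBot.comp (tendsto_id.atTop_div_const Real.two_pi_pos)).mono_right
      atBot_le_cocompact
  refine (h.comp hw).congr fun y ↦ ?_
  rw [Function.comp_apply, intervalIntegral.integral_of_le hL,
    ← MeasureTheory.integral_indicator measurableSet_Ioc]
  refine MeasureTheory.integral_congr_ae (Eventually.of_forall fun t ↦ ?_)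
  by_cases ht : t ∈ Set.Ioc 0 L
  · simp only [Set.indicator_of_mem ht, Circle.smul_def, Real.fourierChar_apply, smul_eq_mul]
    congr 2
    push_cast
    field_simp
  · simp [Set.indicator_of_notMem ht]

/-- Every interval `(x, (1 + ε) x]` with `x` large contains a prime power. -/
theorem exists_isPrimePow_mem_Ioc {ε : ℝ} (hε : 0 < ε) :
    ∀ᶠ x : ℝ in atTop, ∃ n : ℕ, IsPrimePow n ∧ x < n ∧ (n : ℝ) ≤ (1 + ε) * x := by
  obtain ⟨C, hC⟩ := exists_sum_vonMangoldt_div_le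
  obtain ⟨H, hHcont, hH⟩ := exists_continuousOn_vonMangoldt_sub_one
  set δ : ℝ := Real.log (1 + ε) / 2 with hδ
  have hδ0 : 0 < δ := half_pos (Real.log_pos (by linarith))
  have hC0 : 0 ≤ C := by simpa using hC 0 0
  set L : ℝ := 1 + 256 * ((1 + 1 / δ ^ 2) * C) with hL
  have hL1 : 1 ≤ L := by
    have : 0 ≤ (1 + 1 / δ ^ 2) * C := by positivity
    linarith
  have hL0 : 0 < L := by linarith
  set I : ℝ → ℝ → ℂ := fun y σ ↦ ∫ t in (0 : ℝ)..L, Complex.exp (t * y * Complex.I) *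
    (((1 - t / L : ℝ) : ℂ) * H (max 1 σ + t * Complex.I)) with hI
  have hIcont : ∀ y, Continuous (I y) := by
    intro y
    refine intervalIntegral.continuous_parametric_intervalIntegral_of_continuous' ?_ 0 L
    have hcomp : Continuous fun p : ℝ × ℝ ↦ H (max 1 p.1 + p.2 * Complex.I) := by
      have : Continuous fun p : ℝ × ℝ ↦ (((max 1 p.1 : ℝ) : ℂ) + p.2 * Complex.I) := by fun_prop
      refine hHcont.comp_continuous this fun p ↦ ?_
      simp
    simp only [Function.uncurry_def]
    exact Continuous.mul (by fun_prop) (Continuous.mul (by fun_prop) hcomp)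
  have hI1 : ∀ᶠ y in atTop, ‖I y 1‖ < 1 / 128 :=
    ((tendsto_integral_mul_exp (f := fun t ↦ ((1 - t / L : ℝ) : ℂ) *
      H (((max 1 1 : ℝ) : ℂ) + t * Complex.I)) L hL0.le).norm).eventually_lt_const (by simp)
  have hy : ∀ᶠ y in atTop, ∃ n : ℕ, IsPrimePow n ∧ y - δ < Real.log n ∧ Real.log n ≤ y + δ := by
    filter_upwards [hI1, Real.tendsto_exp_atTop.eventually_ge_atTop (4 * L)] with y hy1 hy2
    by_contra! hno
    set A : Finset ℕ := Finset.Ioc ⌊Real.exp y⌋₊ ⌊Real.exp y * (1 + 1 / L)⌋₊ with hA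
    have hApos : ∀ n ∈ A, (n : ℝ) ≠ 0 := fun n hn ↦ by
      have := (Finset.mem_Ioc.mp hn).1
      exact_mod_cast (Nat.zero_lt_of_lt this).ne'
    have hsumcont : ContinuousAt
        (fun σ : ℝ ↦ ∑ n ∈ A, 1 / (n : ℝ) ^ σ * fejer L (y - Real.log n)) 1 := by
      refine tendsto_finsetSum _ fun n hn ↦ ?_
      have hn0 : (0 : ℝ) < n := lt_of_le_of_ne n.cast_nonneg (hApos n hn).symm
      exact ((continuousAt_const.div (Real.continuousAt_const_rpow hn0.ne')
        (Real.rpow_pos_of_pos hn0 _).ne').mul continuousAt_const)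
    have hlow : ∀ᶠ σ in 𝓝[>] (1 : ℝ),
        1 / 32 < ∑ n ∈ A, 1 / (n : ℝ) ^ σ * fejer L (y - Real.log n) := by
      refine (hsumcont.eventually_const_lt ?_).filter_mono nhdsWithin_le_nhds
      simp only [Real.rpow_one]
      exact lt_of_lt_of_le (by norm_num) (le_sum_fejer hL1 hy2)
    have hIlow : ∀ᶠ σ in 𝓝[>] (1 : ℝ), ‖I y σ‖ < 1 / 128 :=
      ((hIcont y).norm.continuousAt.eventually_lt_const hy1).filter_mono nhdsWithin_le_nhds
    obtain ⟨σ, hσ1, hσ2, hσ⟩ := (hlow.and (hIlow.and self_mem_nhdsWithin)).exists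
    replace hσ : 1 < σ := hσ
    have hσ0 : 0 < σ := by linarith
    have hΛ : ∀ s : ℂ, 1 < s.re → LSeriesSummable (fun n ↦ (vonMangoldt n : ℂ)) s :=
      fun s hs ↦ ArithmeticFunction.LSeriesSummable_vonMangoldt hs
    have hone : ∀ s : ℂ, 1 < s.re → LSeriesSummable (fun _ ↦ ((1 : ℝ) : ℂ)) s := fun s hs ↦ by
      simpa [Pi.one_def] using LSeriesSummable_one_iff.mpr hs
    have hs1 := hasSum_fejer hσ0 (hΛ σ (by simpa using hσ)) L y
    have hs2 := hasSum_fejer (a := fun _ ↦ 1) hσ0 (hone σ (by simpa using hσ)) L y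
    have hs3 := hasSum_fejer (a := fun n ↦ vonMangoldt n - 1) hσ0 (by
      simpa [Pi.sub_def] using (hΛ σ (by simpa using hσ)).sub (hone σ (by simpa using hσ))) L y
    have hIσ : (∫ t in (0 : ℝ)..L, ((1 - t / L : ℝ) : ℂ) * (Complex.exp (t * y * Complex.I) *
        LSeries (fun n ↦ ((vonMangoldt n - 1 : ℝ) : ℂ)) (σ + t * Complex.I))) = I y σ := by
      refine intervalIntegral.integral_congr fun t _ ↦ ?_
      have hre : 1 < ((σ : ℂ) + t * Complex.I).re := by simpa using hσ
      have hsub : LSeries (fun n ↦ ((vonMangoldt n - 1 : ℝ) : ℂ)) (σ + t * Complex.I) =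
          H (σ + t * Complex.I) := by
        rw [hH _ hre, ← LSeries_sub (hΛ _ hre) (hone _ hre)]
        simp [Pi.sub_def]
      rw [hsub, max_eq_right hσ.le]
      ring
    rw [hIσ] at hs3
    have hdiff := (hs1.sub hs2).unique (hs3.congr_fun fun n ↦ by ring)
    have hbig := hσ1.trans_le (sum_le_hasSum A
      (fun n _ ↦ mul_nonneg (by positivity) (fejer_nonneg hL0 _)) hs2)
    have hterm : ∀ n : ℕ, vonMangoldt n / (n : ℝ) ^ σ * fejer L (y - Real.log n) ≤
        2 / L * (1 + 1 / δ ^ 2) * (vonMangoldt n / n * (1 / (1 + (Real.log n - y) ^ 2))) := by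
      intro n
      by_cases hn : IsPrimePow n
      swap
      · simp [ArithmeticFunction.vonMangoldt_eq_zero_iff.mpr hn]
      have hn1 : (1 : ℝ) ≤ n := by exact_mod_cast hn.pos
      have hδu : δ ^ 2 ≤ (Real.log n - y) ^ 2 := by
        rw [sq_le_sq, abs_of_pos hδ0]
        by_contra! hlt
        have := abs_lt.mp hlt
        linarith [hno n hn (by linarith)]
      have hu2 : 0 < (Real.log n - y) ^ 2 := (pow_pos hδ0 2).trans_le hδu
      have hu : y - Real.log n ≠ 0 := by
        intro h0
        rw [show Real.log n - y = -(y - Real.log n) by ring, h0] at hu2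
        simp at hu2
      have hpow : (n : ℝ) ≤ (n : ℝ) ^ σ := by
        simpa using Real.rpow_le_rpow_of_exponent_le hn1 hσ.le
      have hK : fejer L (y - Real.log n) ≤
          2 / L * (1 + 1 / δ ^ 2) * (1 / (1 + (Real.log n - y) ^ 2)) := by
        refine (fejer_le hL0 hu).trans ?_
        rw [show (y - Real.log n) ^ 2 = (Real.log n - y) ^ 2 by ring, mul_one_div,
          div_le_div_iff₀ (by positivity) (by positivity)]
        have h1 : 1 ≤ (Real.log n - y) ^ 2 * (1 / δ ^ 2) := by
          rw [mul_one_div, one_le_div (by positivity)]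
          exact hδu
        calc 2 * (1 + (Real.log n - y) ^ 2)
            ≤ 2 * ((Real.log n - y) ^ 2 * (1 / δ ^ 2) + (Real.log n - y) ^ 2) := by linarith
          _ = _ := by field_simp; ring
      have hΛ0 : 0 ≤ vonMangoldt n := ArithmeticFunction.vonMangoldt_nonneg
      calc _ ≤ vonMangoldt n / n *
            (2 / L * (1 + 1 / δ ^ 2) * (1 / (1 + (Real.log n - y) ^ 2))) := by
            have := fejer_nonneg hL0 (y - Real.log n)
            gcongr
        _ = _ := by ring
    have hsmall := le_of_tendsto' hs1.tendsto_sum_nat fun N ↦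
      calc _ ≤ ∑ n ∈ Finset.range N, 2 / L * (1 + 1 / δ ^ 2) *
            (vonMangoldt n / n * (1 / (1 + (Real.log n - y) ^ 2))) :=
            Finset.sum_le_sum fun n _ ↦ hterm n
        _ ≤ 2 / L * (1 + 1 / δ ^ 2) * C := by
            rw [← Finset.mul_sum]
            gcongr
            exact hC y N
        _ ≤ 1 / 128 := by
            rw [show 2 / L * (1 + 1 / δ ^ 2) * C = 2 * ((1 + 1 / δ ^ 2) * C) / L by ring,
              div_le_iff₀ hL0]
            linarith
    have := (abs_le.mp ((Complex.abs_re_le_norm _).trans hσ2.le)).1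
    linarith
  have hlog : Tendsto (fun x ↦ Real.log x + δ) atTop atTop :=
    tendsto_atTop_add_const_right _ _ Real.tendsto_log_atTop
  filter_upwards [hlog.eventually hy, eventually_gt_atTop 0] with x hx hx0
  obtain ⟨n, hn, h1, h2⟩ := hx
  have hn0 : (0 : ℝ) < n := by exact_mod_cast hn.pos
  refine ⟨n, hn, (Real.log_lt_log_iff hx0 hn0).mp (by linarith),
    (Real.log_le_log_iff hn0 (by positivity)).mp ?_⟩
  rw [Real.log_mul (by linarith) hx0.ne']
  linarith

lemma q_mem {x : ℕ} (hx : 0 < x) : (IsPrimePow (q x) ∨ q x = 1) ∧ q x ≤ x :=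
  Nat.sSup_mem (s := {m : ℕ | (IsPrimePow m ∨ m = 1) ∧ m ≤ x}) ⟨1, .inr rfl, hx⟩
    ⟨x, fun _ h ↦ h.2⟩

lemma le_q {m x : ℕ} (hm : IsPrimePow m ∨ m = 1) (h : m ≤ x) : m ≤ q x :=
  le_csSup (s := {m : ℕ | (IsPrimePow m ∨ m = 1) ∧ m ≤ x}) ⟨x, fun _ h ↦ h.2⟩ ⟨hm, h⟩

lemma q_pos {x : ℕ} (hx : 0 < x) : 0 < q x := le_q (.inr rfl) hx

lemma P_of_not {x : ℕ} (h : ¬(IsPrimePow x ∨ x = 1)) : P x = x - q x := by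
  rw [not_or] at h
  rw [P, if_neg h.2, if_neg h.1]

lemma P_pos_of_not {x : ℕ} (hx : 0 < x) (h : ¬(IsPrimePow x ∨ x = 1)) : 0 < P x := by
  rw [P_of_not h, Nat.sub_pos_iff_lt]
  exact lt_of_le_of_ne (q_mem hx).2 fun he ↦ h (he ▸ (q_mem hx).1)

lemma S_eq_one {x : ℕ} (h : IsPrimePow x ∨ x = 1) : S x = 1 := by
  have hmem : 1 ∈ {n : ℕ | 1 ≤ n ∧ (IsPrimePow (orbit x n) ∨ orbit x n = 1)} := ⟨le_rfl, h⟩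
  exact le_antisymm (Nat.sInf_le hmem) (Nat.sInf_mem ⟨1, hmem⟩).1

lemma orbit_succ (x : ℕ) {n : ℕ} (hn : 1 ≤ n) : orbit x (n + 1) = orbit (P x) n := by
  obtain ⟨k, rfl⟩ := Nat.exists_eq_add_of_le' hn
  simp [orbit, Function.iterate_succ_apply]

lemma exists_settled {x : ℕ} (hx : 0 < x) :
    ∃ n, 1 ≤ n ∧ (IsPrimePow (orbit x n) ∨ orbit x n = 1) := by
  induction x using Nat.strong_induction_on with
  | _ x ih =>
    by_cases h : IsPrimePow x ∨ x = 1
    · exact ⟨1, le_rfl, h⟩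
    · have hlt : P x < x := by
        rw [P_of_not h]
        exact Nat.sub_lt hx (q_pos hx)
      obtain ⟨n, hn, hset⟩ := ih (P x) hlt (P_pos_of_not hx h)
      exact ⟨n + 1, by lia, by rwa [orbit_succ x hn]⟩

lemma S_spec {x : ℕ} (hx : 0 < x) :
    1 ≤ S x ∧ (IsPrimePow (orbit x (S x)) ∨ orbit x (S x) = 1) :=
  Nat.sInf_mem (s := {n : ℕ | 1 ≤ n ∧ (IsPrimePow (orbit x n) ∨ orbit x n = 1)})
    (exists_settled hx)

lemma S_le {x n : ℕ} (hn : 1 ≤ n) (h : IsPrimePow (orbit x n) ∨ orbit x n = 1) : S x ≤ n :=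
  Nat.sInf_le (s := {n : ℕ | 1 ≤ n ∧ (IsPrimePow (orbit x n) ∨ orbit x n = 1)}) ⟨hn, h⟩

lemma S_eq_succ {x : ℕ} (hx : 0 < x) (h : ¬(IsPrimePow x ∨ x = 1)) : S x = S (P x) + 1 := by
  have h1 := S_spec (P_pos_of_not hx h)
  have h2 := S_spec hx
  refine le_antisymm (S_le (by lia) ?_) ?_
  · rw [orbit_succ x h1.1]
    exact h1.2
  · have hne : S x ≠ 1 := fun he ↦ h (by simpa [he, orbit] using h2.2)
    obtain ⟨k, hk⟩ := Nat.exists_eq_add_of_le' h2.1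
    have hk1 : 1 ≤ k := by lia
    rw [hk, orbit_succ x hk1] at h2
    rw [hk]
    exact Nat.add_le_add_right (S_le hk1 h2.2) 1

/-- There are arbitrarily long runs of consecutive integers that are not prime powers. -/
lemma exists_forall_not_isPrimePow (g : ℕ) :
    ∃ N : ℕ, 0 < N ∧ ∀ i, 2 ≤ i → i ≤ g → ¬IsPrimePow (N + i) := by
  refine ⟨(Nat.factorial g) ^ 2, by positivity, fun i hi2 hig hpp ↦ ?_⟩
  obtain ⟨k, hk⟩ := Nat.dvd_factorial (by lia : 0 < i) hig
  have hk0 : 0 < k := Nat.pos_of_ne_zero fun h ↦ (Nat.factorial_pos g).ne' (by simp [hk, h])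
  have hfac : (Nat.factorial g) ^ 2 + i = i * (i * k ^ 2 + 1) := by rw [hk]; ring
  have hcop : Nat.Coprime i (i * k ^ 2 + 1) := by simp
  rw [hfac] at hpp
  have hpos : 0 < i * k ^ 2 := by positivity
  rcases (hcop.isPrimePow_dvd_mul hpp).mp dvd_rfl with h | h
  · have := Nat.le_of_dvd (by lia) h
    nlinarith
  · have := Nat.le_of_dvd (by lia) h
    nlinarith

lemma exists_S_eq {s : ℕ} (hs : 1 ≤ s) : ∃ x, 0 < x ∧ S x = s := by
  induction s, hs using Nat.le_induction with
  | base => exact ⟨1, one_pos, S_eq_one (.inr rfl)⟩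
  | succ s hs ih =>
    obtain ⟨x, hx, hxs⟩ := ih
    obtain ⟨N, hN, hgap⟩ := exists_forall_not_isPrimePow (x + 1)
    set Q := q (N + 1) with hQ
    have hQ0 : 0 < Q := q_pos (by lia)
    have hQle : Q ≤ N + 1 := (q_mem (by lia)).2
    have hbig : ∀ m, IsPrimePow m ∨ m = 1 → m ≤ Q + x → m ≤ Q := by
      intro m hm hmx
      refine le_q hm (not_lt.mp fun hlt ↦ ?_)
      obtain ⟨i, rfl⟩ := Nat.exists_eq_add_of_le (show N ≤ m by lia)
      exact hm.elim (hgap i (by lia) (by lia)) (by lia)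
    have hnot : ¬(IsPrimePow (Q + x) ∨ Q + x = 1) := fun h ↦ by
      have := hbig _ h le_rfl
      lia
    have hq : q (Q + x) = Q := le_antisymm
      (hbig _ (q_mem (by lia)).1 (q_mem (by lia)).2) (le_q (q_mem (by lia)).1 (by lia))
    refine ⟨Q + x, by lia, ?_⟩
    rw [S_eq_succ (by lia) hnot, P_of_not hnot, hq, Nat.add_sub_cancel_left, hxs]

lemma xi_mem {s : ℕ} (hs : 1 ≤ s) : 0 < xi s ∧ S (xi s) = s := Nat.sInf_mem (exists_S_eq hs)

lemma xi_le {x : ℕ} (hx : 0 < x) : xi (S x) ≤ x := Nat.sInf_le ⟨hx, rfl⟩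

lemma not_isPrimePow_xi_succ {s : ℕ} (hs : 1 ≤ s) :
    ¬(IsPrimePow (xi (s + 1)) ∨ xi (s + 1) = 1) := fun h ↦ by
  have h1 := S_eq_one h
  rw [(xi_mem (by lia)).2] at h1
  lia

lemma xi_add_q_le {s : ℕ} (hs : 1 ≤ s) : xi s + q (xi (s + 1)) ≤ xi (s + 1) := by
  obtain ⟨h0, hS⟩ := xi_mem (show 1 ≤ s + 1 by lia)
  have hnot := not_isPrimePow_xi_succ hs
  have hP := S_eq_succ h0 hnot
  have hle := xi_le (P_pos_of_not h0 hnot)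
  rw [show S (P (xi (s + 1))) = s by lia, P_of_not hnot] at hle
  have := (q_mem h0).2
  lia

lemma tendsto_xi_succ : Tendsto (fun s ↦ xi (s + 1)) atTop atTop := by
  refine Function.Injective.nat_tendsto_atTop fun a b hab ↦ ?_
  have ha := (xi_mem (show 1 ≤ a + 1 by lia)).2
  have hb := (xi_mem (show 1 ≤ b + 1 by lia)).2
  beta_reduce at hab
  rw [hab, hb] at ha
  lia

lemma tendsto_q : Tendsto q atTop atTop := by
  refine tendsto_atTop.mpr fun b ↦ ?_
  obtain ⟨p, hbp, hp⟩ := Nat.exists_infinite_primes b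
  filter_upwards [eventually_ge_atTop p] with x hx
  exact hbp.trans (le_q (.inl hp.isPrimePow) hx)

lemma tendsto_q_xi_succ_div_xi :
    Tendsto (fun s : ℕ ↦ (q (xi (s + 1)) : ℝ) / (xi s : ℝ)) atTop atTop := by
  refine tendsto_atTop.mpr fun b ↦ ?_
  set c := max b 1 with hc
  have hc0 : 0 < c := lt_of_lt_of_le one_pos (le_max_right _ _)
  have hq : Tendsto (fun s ↦ (q (xi (s + 1)) : ℝ)) atTop atTop :=
    tendsto_natCast_atTop_atTop.comp (tendsto_q.comp tendsto_xi_succ)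
  filter_upwards [hq.eventually (exists_isPrimePow_mem_Ioc (inv_pos.mpr hc0)),
    eventually_ge_atTop 1] with s ⟨n, hn, h1, h2⟩ hs
  have hxi : (0 : ℝ) < xi s := by exact_mod_cast (xi_mem hs).1
  have hlt : xi (s + 1) < n := by
    by_contra! hle
    have := le_q (.inl hn) hle
    exact absurd h1 (by exact_mod_cast this.not_gt)
  have hsum : (xi s : ℝ) + q (xi (s + 1)) ≤ n := by
    exact_mod_cast (xi_add_q_le hs).trans hlt.le
  refine (le_max_left b 1).trans ?_
  rw [← hc, le_div_iff₀ hxi]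
  have h3 : (xi s : ℝ) ≤ c⁻¹ * q (xi (s + 1)) := by linarith
  calc c * xi s ≤ c * (c⁻¹ * q (xi (s + 1))) := by gcongr
    _ = _ := by field_simp

theorem stmt_17 :
    Filter.Tendsto (fun s : ℕ => (xi (s + 1) : ℝ) / (xi s : ℝ)) Filter.atTop Filter.atTop ∧
    Filter.Tendsto (fun s : ℕ => (q (xi (s + 1)) : ℝ) / (q (xi s) : ℝ))
      Filter.atTop Filter.atTop := by
  constructor
  · refine tendsto_atTop_mono' _ ?_ tendsto_q_xi_succ_div_xi
    filter_upwards with s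
    gcongr
    exact (q_mem (xi_mem (by lia)).1).2
  · refine tendsto_atTop_mono' _ ?_ tendsto_q_xi_succ_div_xi
    filter_upwards [eventually_ge_atTop 1] with s hs
    have h0 := (xi_mem hs).1
    have : (0 : ℝ) < q (xi s) := by exact_mod_cast q_pos h0
    gcongr
    exact (q_mem h0).2
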